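/- Let $N\ge3$ and let $\rho\in C^1([0,\infty))$ satisfy $\rho(0)=1$, condition $(\rho_0)$ with some exponent $\gamma>0$, and condition $(\rho_1)$. Let $a>0$, $b>0$, $p=2^*$ and $q=2_*$. Suppose $u$ is a nonnegative classical solution of problem $(\mathcal{P}_0)$ whose first- and second-order partial derivatives extend continuously to $\overline{\mathbb{R}^N_+}$, and assume $\int_{\mathbb{R}^N_+}\rho(x_N)|\nabla u|^2\,dx<\infty$, $u\in L^{2^*}(\mathbb{R}^N_+)$, $u(\cdot,0)\in L^{2_*}(\mathbb{R}^{N-1})$, and that the energy identity $\int_{\mathbb{R}^N_+}\rho(x_N)|\nabla u|^2\,dx=a\int_{\mathbb{R}^N_+}u^{2^*}\,dx+b\int_{\mathbb{R}^{N-1}}u(x',0)^{2_*}\,dx'$ holds. Then $u\equiv0$. -/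

import Mathlib

open MeasureTheory Filter
open scoped Topology ENNReal

noncomputable section

/-- The last coordinate of a point of `ℝ^N`. -/
def xN (N : ℕ) (hN : 0 < N) (x : EuclideanSpace ℝ (Fin N)) : ℝ :=
  x ⟨N - 1, Nat.sub_lt hN Nat.one_pos⟩

/-- The open upper half-space `ℝ^N₊`. -/
def Hplus (N : ℕ) (hN : 0 < N) : Set (EuclideanSpace ℝ (Fin N)) :=
  {x | 0 < xN N hN x}

/-- The point `(y, t) ∈ ℝ^N` with horizontal part `y ∈ ℝ^(N-1)` and last coordinate `t`. -/
def mkPt (N : ℕ) (y : EuclideanSpace ℝ (Fin (N - 1))) (t : ℝ) :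
    EuclideanSpace ℝ (Fin N) :=
  (WithLp.equiv 2 (Fin N → ℝ)).symm fun i => if h : (i : ℕ) < N - 1 then y ⟨(i : ℕ), h⟩ else t

/-- The boundary point `(y, 0)`. -/
def bPt (N : ℕ) (y : EuclideanSpace ℝ (Fin (N - 1))) : EuclideanSpace ℝ (Fin N) :=
  mkPt N y 0

/-- Partial derivative of `u` in the `i`-th coordinate direction. -/
def pd (N : ℕ) (u : EuclideanSpace ℝ (Fin N) → ℝ) (i : Fin N)
    (x : EuclideanSpace ℝ (Fin N)) : ℝ :=
  fderiv ℝ u x (EuclideanSpace.single i 1)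

/-- `div (w ∇u)` written as a sum of coordinate partial derivatives. -/
def divW (N : ℕ) (w u : EuclideanSpace ℝ (Fin N) → ℝ)
    (x : EuclideanSpace ℝ (Fin N)) : ℝ :=
  ∑ i, pd N (fun z => w z * pd N u i z) i x

/-- `u` is a (pointwise) solution of problem `(P₀)`:
`-div(ρ(x_N) ∇u) = a |u|^(p-2) u` in `ℝ^N₊` and
`-∂u/∂x_N = b |u|^(q-2) u` on `ℝ^(N-1)`. -/
def IsSolutionP0 (N : ℕ) (hN : 0 < N) (ρ : ℝ → ℝ) (a b p q : ℝ)
    (u : EuclideanSpace ℝ (Fin N) → ℝ) : Prop :=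
  (∀ x, 0 < xN N hN x →
    -divW N (fun z => ρ (xN N hN z)) u x = a * |u x| ^ (p - 2) * u x) ∧
  ∀ y : EuclideanSpace ℝ (Fin (N - 1)),
    -pd N u ⟨N - 1, Nat.sub_lt hN Nat.one_pos⟩ (bPt N y) =
      b * |u (bPt N y)| ^ (q - 2) * u (bPt N y)

theorem half_div_pi (m : ℕ) (F : Fin (m+1) → (Fin (m+1) → ℝ) → ℝ)
    (hF : ∀ i, ContDiff ℝ 1 (F i)) (hc : ∀ i, HasCompactSupport (F i)) :
    ∫ x in {x : Fin (m+1) → ℝ | 0 < x (Fin.last m)}, ∑ i, fderiv ℝ (F i) x (Pi.single i 1)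
      = - ∫ y : Fin m → ℝ, F (Fin.last m) ((Fin.last m).insertNth (0:ℝ) y) := by
  obtain ⟨M, hM0, hM⟩ : ∃ M : ℝ, 0 < M ∧ ∀ x : Fin (m+1) → ℝ, (∃ j, M ≤ |x j|) →
      ∀ i, x ∉ tsupport (F i) := by
    have h1 : ∀ i, ∃ r : ℝ, ∀ x ∈ tsupport (F i), ‖x‖ ≤ r := fun i =>
      (hc i).isCompact.isBounded.exists_norm_le
    choose r hr using h1
    refine ⟨∑ i, |r i| + 1, by positivity, ?_⟩
    rintro x ⟨j, hj⟩ i hx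
    have h2 := hr i x hx
    have h3 := norm_le_pi_norm x j
    rw [Real.norm_eq_abs] at h3
    have h4 : |r i| ≤ ∑ i, |r i| :=
      Finset.single_le_sum (f := fun i => |r i|) (fun _ _ => abs_nonneg _) (Finset.mem_univ i)
    have h5 := le_abs_self (r i)
    linarith
  have hz : ∀ x : Fin (m+1) → ℝ, (∃ j, M ≤ |x j|) → ∀ i, F i x = 0 := fun x hx i =>
    image_eq_zero_of_notMem_tsupport (hM x hx i)
  have hz' : ∀ x : Fin (m+1) → ℝ, (∃ j, M ≤ |x j|) → ∀ i, fderiv ℝ (F i) x = 0 := fun x hx i => by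
    have := (support_fderiv_subset ℝ (f := F i))
    by_contra h
    exact hM x hx i (this h)
  set A : Fin (m+1) → ℝ := fun j => if j = Fin.last m then 0 else -M with hA
  set B : Fin (m+1) → ℝ := fun _ => M with hB
  have hAB : A ≤ B := by
    intro j
    simp only [hA, hB]
    split_ifs <;> linarith
  have hcont : Continuous fun x => ∑ i, fderiv ℝ (F i) x (Pi.single i (1:ℝ)) := by
    refine continuous_finsetSum _ fun i _ => ?_
    exact ((hF i).continuous_fderiv one_ne_zero).clm_apply continuous_const
  have key := integral_divergence_of_hasFDerivAt_off_countable' A B hAB F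
    (fun i x => fderiv ℝ (F i) x) ∅ Set.countable_empty
    (fun i => (hF i).continuous.continuousOn)
    (fun x _ i => ((hF i).differentiable one_ne_zero x).hasFDerivAt)
    (hcont.continuousOn.integrableOn_Icc)
  have hL : ∫ x in {x : Fin (m+1) → ℝ | 0 < x (Fin.last m)}, ∑ i, fderiv ℝ (F i) x (Pi.single i 1)
      = ∫ x in Set.Icc A B, ∑ i, fderiv ℝ (F i) x (Pi.single i 1) := by
    rw [volume_pi, ← setIntegral_congr_set Measure.univ_pi_Ioc_ae_eq_Icc]
    apply setIntegral_eq_of_subset_of_forall_sdiff_eq_zero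
    · exact measurableSet_lt measurable_const (measurable_pi_apply _)
    · intro x hx
      have := (hx (Fin.last m) (Set.mem_univ _)).1
      simpa [hA] using this
    · rintro x ⟨hx1, hx2⟩
      have : ∃ j, M ≤ |x j| := by
        by_contra hcon
        push Not at hcon
        apply hx2
        intro j _
        have := abs_lt.1 (hcon j)
        refine ⟨?_, this.2.le⟩
        simp only [hA]
        split_ifs with h
        · rw [h]; exact hx1
        · exact this.1
      simp [hz' x this]
  rw [hL, key, Fin.sum_univ_castSucc]
  have hfront : ∀ i, ∀ y : Fin m → ℝ, F i (i.insertNth (B i) y) = 0 := fun i y =>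
    hz _ ⟨i, by simp [hB, le_abs_self]⟩ i
  have hback : ∀ i : Fin m, ∀ y : Fin m → ℝ,
      F i.castSucc (i.castSucc.insertNth (A i.castSucc) y) = 0 := fun i y =>
    hz _ ⟨i.castSucc, by simp [hA, le_abs_self]⟩ _
  simp only [hfront, hback]
  simp only [integral_zero, sub_zero, Finset.sum_const_zero, zero_sub, zero_add]
  congr 1
  have : A (Fin.last m) = 0 := by simp [hA]
  rw [this]
  apply setIntegral_eq_integral_of_forall_compl_eq_zero
  intro y hy
  apply hz
  by_contra hcon
  push Not at hcon
  apply hy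
  rw [Set.mem_Icc, Pi.le_def, Pi.le_def]
  have hh : ∀ j, |y j| < M := fun j => by simpa using hcon j.castSucc
  constructor
  · intro j
    simp [hA]
    linarith [(abs_lt.1 (hh j)).1]
  · intro j
    simp [hB]
    linarith [(abs_lt.1 (hh j)).2]

theorem half_div (m : ℕ) (F : Fin (m+1) → EuclideanSpace ℝ (Fin (m+1)) → ℝ)
    (hF : ∀ i, ContDiff ℝ 1 (F i)) (hc : ∀ i, HasCompactSupport (F i)) :
    ∫ x in {x : EuclideanSpace ℝ (Fin (m+1)) | 0 < x (Fin.last m)}, ∑ i, pd (m+1) (F i) i x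
      = - ∫ y : EuclideanSpace ℝ (Fin m), F (Fin.last m) (mkPt (m+1) y 0) := by
  let T : (Fin (m+1) → ℝ) ≃L[ℝ] EuclideanSpace ℝ (Fin (m+1)) :=
    (EuclideanSpace.equiv (Fin (m+1)) ℝ).symm
  have hT : ∀ x, T x = WithLp.toLp 2 x := fun x => rfl
  have h := half_div_pi m (fun i => F i ∘ T) (fun i => (hF i).comp T.contDiff)
    (fun i => (hc i).comp_homeomorph T.toHomeomorph)
  have e1 : ∀ x, ∑ i, fderiv ℝ (F i ∘ T) x (Pi.single i 1) = ∑ i, pd (m+1) (F i) i (WithLp.toLp 2 x) := by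
    intro x
    refine Finset.sum_congr rfl fun i _ => ?_
    rw [fderiv_comp _ ((hF i).differentiable one_ne_zero _) T.differentiableAt]
    simp [pd, T.fderiv, hT]
  rw [← (PiLp.volume_preserving_toLp (Fin (m+1))).setIntegral_preimage_emb
    (MeasurableEquiv.toLp 2 _).measurableEmbedding,
    ← (PiLp.volume_preserving_toLp (Fin m)).integral_comp
    (MeasurableEquiv.toLp 2 _).measurableEmbedding]
  simp only [e1] at h
  refine Eq.trans h ?_
  congr 1
  refine integral_congr_ae (Eventually.of_forall fun y => ?_)
  simp only [Function.comp, hT]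
  congr 1
  ext i
  refine Fin.lastCases ?_ (fun j => ?_) i
  · simp [mkPt]
  · simp [mkPt]

theorem pd_mul' {n : ℕ} {f g : EuclideanSpace ℝ (Fin n) → ℝ} {x : EuclideanSpace ℝ (Fin n)}
    (i : Fin n) (hf : DifferentiableAt ℝ f x) (hg : DifferentiableAt ℝ g x) :
    pd n (fun z => f z * g z) i x = pd n f i x * g x + f x * pd n g i x := by
  unfold pd
  rw [fderiv_fun_mul hf hg]
  simp
  ring

theorem pd_add' {n : ℕ} {f g : EuclideanSpace ℝ (Fin n) → ℝ} {x : EuclideanSpace ℝ (Fin n)}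
    (i : Fin n) (hf : DifferentiableAt ℝ f x) (hg : DifferentiableAt ℝ g x) :
    pd n (fun z => f z + g z) i x = pd n f i x + pd n g i x := by
  unfold pd
  rw [fderiv_fun_add hf hg]
  simp

theorem pd_sum' {n : ℕ} {ι : Type*} (S : Finset ι) {f : ι → EuclideanSpace ℝ (Fin n) → ℝ}
    {x : EuclideanSpace ℝ (Fin n)}
    (i : Fin n) (hf : ∀ j ∈ S, DifferentiableAt ℝ (f j) x) :
    pd n (fun z => ∑ j ∈ S, f j z) i x = ∑ j ∈ S, pd n (f j) i x := by
  unfold pd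
  rw [fderiv_fun_sum hf]
  simp

theorem pd_coord {n : ℕ} (i j : Fin n) (x : EuclideanSpace ℝ (Fin n)) :
    pd n (fun z => z j) i x = if j = i then 1 else 0 := by
  unfold pd
  have : fderiv ℝ (fun z : EuclideanSpace ℝ (Fin n) => z j) x
      = (EuclideanSpace.proj j : EuclideanSpace ℝ (Fin n) →L[ℝ] ℝ) :=
    (EuclideanSpace.proj j : EuclideanSpace ℝ (Fin n) →L[ℝ] ℝ).fderiv
  rw [this]
  simp

theorem pd_comp {n : ℕ} {f : EuclideanSpace ℝ (Fin n) → ℝ} {g : ℝ → ℝ} {g' : ℝ}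
    {x : EuclideanSpace ℝ (Fin n)}
    (i : Fin n) (hg : HasDerivAt g g' (f x)) (hf : DifferentiableAt ℝ f x) :
    pd n (fun z => g (f z)) i x = g' * pd n f i x := by
  unfold pd
  have := (hg.comp_hasFDerivAt x hf.hasFDerivAt).fderiv
  have e : fderiv ℝ (fun z => g (f z)) x = g' • fderiv ℝ f x := this
  rw [e]
  simp

theorem contDiff_coord {n : ℕ} {k : WithTop ℕ∞} (j : Fin n) :
    ContDiff ℝ k (fun z : EuclideanSpace ℝ (Fin n) => z j) :=
  (EuclideanSpace.proj j : EuclideanSpace ℝ (Fin n) →L[ℝ] ℝ).contDiff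

theorem contDiff_pd {n : ℕ} {u : EuclideanSpace ℝ (Fin n) → ℝ} (hu : ContDiff ℝ 2 u) (i : Fin n) :
    ContDiff ℝ 1 (pd n u i) := by
  unfold pd
  exact (hu.fderiv_right (m := 1) (by norm_num)).clm_apply contDiff_const

theorem continuous_pd {n : ℕ} {u : EuclideanSpace ℝ (Fin n) → ℝ} (hu : ContDiff ℝ 1 u) (i : Fin n) :
    Continuous (pd n u i) := by
  unfold pd
  exact (hu.continuous_fderiv one_ne_zero).clm_apply continuous_const

theorem pd_symm {n : ℕ} {u : EuclideanSpace ℝ (Fin n) → ℝ} (hu : ContDiff ℝ 2 u) (i j : Fin n)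
    (x : EuclideanSpace ℝ (Fin n)) : pd n (pd n u j) i x = pd n (pd n u i) j x := by
  have hs : IsSymmSndFDerivAt ℝ u x := (hu.contDiffAt).isSymmSndFDerivAt (by simp)
  have hd : DifferentiableAt ℝ (fderiv ℝ u) x :=
    (hu.fderiv_right (m := 1) (by norm_num)).differentiable one_ne_zero x
  have : ∀ i j, pd n (pd n u j) i x
      = fderiv ℝ (fderiv ℝ u) x (EuclideanSpace.single i 1) (EuclideanSpace.single j 1) := by
    intro i j
    unfold pd
    rw [fderiv_clm_apply hd (differentiableAt_const _)]
    simp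
  rw [this, this]
  exact hs _ _

/-- The Pohozaev vector field. -/
def Vf (m : ℕ) (ρ : ℝ → ℝ) (c p : ℝ) (u : EuclideanSpace ℝ (Fin (m+1)) → ℝ) (i : Fin (m+1))
    (x : EuclideanSpace ℝ (Fin (m+1))) : ℝ :=
  (∑ j, x j * pd (m+1) u j x) * (ρ (x (Fin.last m)) * pd (m+1) u i x)
    + (-(1/2) * (ρ (x (Fin.last m)) * ∑ j, pd (m+1) u j x * pd (m+1) u j x) + c * |u x| ^ p) * x i

theorem contDiff_Vf (m : ℕ) (ρ : ℝ → ℝ) (hρ : ContDiff ℝ 1 ρ) (c p : ℝ) (hp : 1 < p)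
    (u : EuclideanSpace ℝ (Fin (m+1)) → ℝ) (hu : ContDiff ℝ 2 u) (i : Fin (m+1)) :
    ContDiff ℝ 1 (Vf m ρ c p u i) := by
  have h1 : ContDiff ℝ 1 (fun x => |u x| ^ p) := (hu.of_le (by norm_num)).norm_rpow hp
  have h2 : ContDiff ℝ 1 (fun x : EuclideanSpace ℝ (Fin (m+1)) => ρ (x (Fin.last m))) :=
    hρ.comp (contDiff_coord _)
  unfold Vf
  exact ((ContDiff.sum fun j _ => (contDiff_coord j).mul (contDiff_pd hu j)).mul
    (h2.mul (contDiff_pd hu i))).add (((contDiff_const.mul (h2.mul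
      (ContDiff.sum fun j _ => (contDiff_pd hu j).mul (contDiff_pd hu j)))).add
      (contDiff_const.mul h1)).mul (contDiff_coord i))

theorem div_Vf (m : ℕ) (ρ : ℝ → ℝ) (hρ : ContDiff ℝ 1 ρ) (c p : ℝ) (hp : 1 < p)
    (u : EuclideanSpace ℝ (Fin (m+1)) → ℝ) (hu : ContDiff ℝ 2 u)
    (x : EuclideanSpace ℝ (Fin (m+1))) :
    ∑ i, pd (m+1) (Vf m ρ c p u i) i x =
      (∑ j, x j * pd (m+1) u j x) * divW (m+1) (fun z => ρ (z (Fin.last m))) u x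
      + (1 - ((m:ℝ)+1)/2) * (ρ (x (Fin.last m)) * ∑ j, pd (m+1) u j x * pd (m+1) u j x)
      - (1/2) * (deriv ρ (x (Fin.last m)) * x (Fin.last m)) * ∑ j, pd (m+1) u j x * pd (m+1) u j x
      + c * p * |u x| ^ (p-2) * u x * (∑ j, x j * pd (m+1) u j x)
      + c * ((m:ℝ)+1) * |u x| ^ p := by
  have h1 : ContDiff ℝ 1 (fun x => |u x| ^ p) := (hu.of_le (by norm_num)).norm_rpow hp
  have h2 : ContDiff ℝ 1 (fun x : EuclideanSpace ℝ (Fin (m+1)) => ρ (x (Fin.last m))) :=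
    hρ.comp (contDiff_coord _)
  have hu1 : Differentiable ℝ u := hu.differentiable two_ne_zero
  have d1 := h1.differentiable one_ne_zero x
  have d2 := h2.differentiable one_ne_zero x
  have dp : ∀ j, DifferentiableAt ℝ (pd (m+1) u j) x := fun j =>
    (contDiff_pd hu j).differentiable one_ne_zero x
  have dc : ∀ j, DifferentiableAt ℝ (fun z : EuclideanSpace ℝ (Fin (m+1)) => z j) x := fun j =>
    (contDiff_coord (k := 1) j).differentiable one_ne_zero x
  have dh : DifferentiableAt ℝ (fun z => ∑ j, z j * pd (m+1) u j z) x :=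
    DifferentiableAt.fun_sum fun j _ => (dc j).fun_mul (dp j)
  have ds : DifferentiableAt ℝ (fun z => ∑ j, pd (m+1) u j z * pd (m+1) u j z) x :=
    DifferentiableAt.fun_sum fun j _ => (dp j).fun_mul (dp j)
  have e1 : ∀ i, pd (m+1) (fun x => |u x| ^ p) i x = p * |u x| ^ (p-2) * u x * pd (m+1) u i x :=
    fun i => pd_comp i (hasDerivAt_abs_rpow (u x) hp) (hu1 x)
  have e2 : ∀ i, pd (m+1) (fun x => ρ (x (Fin.last m))) i x
      = deriv ρ (x (Fin.last m)) * if Fin.last m = i then 1 else 0 := fun i => by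
    rw [← pd_coord i (Fin.last m) x]
    exact pd_comp i (f := fun z : EuclideanSpace ℝ (Fin (m+1)) => z (Fin.last m))
      (hρ.differentiable one_ne_zero _).hasDerivAt (dc _)
  have eh : ∀ i, pd (m+1) (fun z => ∑ j, z j * pd (m+1) u j z) i x
      = pd (m+1) u i x + ∑ j, x j * pd (m+1) (pd (m+1) u j) i x := fun i => by
    rw [pd_sum' _ _ (fun j _ => (dc j).fun_mul (dp j))]
    simp_rw [pd_mul' i (dc _) (dp _), pd_coord, Finset.sum_add_distrib]
    simp
  have es : ∀ i, pd (m+1) (fun z => ∑ j, pd (m+1) u j z * pd (m+1) u j z) i x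
      = 2 * ∑ j, pd (m+1) u j x * pd (m+1) (pd (m+1) u i) j x := fun i => by
    rw [pd_sum' _ _ (fun j _ => (dp j).fun_mul (dp j)), Finset.mul_sum]
    refine Finset.sum_congr rfl fun j _ => ?_
    rw [pd_mul' i (dp _) (dp _), pd_symm hu i j]
    ring
  have econst : ∀ (k : ℝ) i, pd (m+1) (fun _ => k) i x = 0 := fun k i => by simp [pd]
  have eV : ∀ i, pd (m+1) (Vf m ρ c p u i) i x =
      (pd (m+1) u i x + ∑ j, x j * pd (m+1) (pd (m+1) u j) i x)
        * (ρ (x (Fin.last m)) * pd (m+1) u i x)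
      + (∑ j, x j * pd (m+1) u j x) * pd (m+1) (fun z => ρ (z (Fin.last m)) * pd (m+1) u i z) i x
      + (-(1/2) * ((deriv ρ (x (Fin.last m)) * if Fin.last m = i then 1 else 0)
            * (∑ j, pd (m+1) u j x * pd (m+1) u j x)
          + ρ (x (Fin.last m)) * (2 * ∑ j, pd (m+1) u j x * pd (m+1) (pd (m+1) u i) j x))
        + c * (p * |u x| ^ (p-2) * u x * pd (m+1) u i x)) * x i
      + (-(1/2) * (ρ (x (Fin.last m)) * ∑ j, pd (m+1) u j x * pd (m+1) u j x) + c * |u x| ^ p) := by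
    intro i
    unfold Vf
    have dws := d2.fun_mul ds
    have dk : ∀ k : ℝ, DifferentiableAt ℝ (fun _ : EuclideanSpace ℝ (Fin (m+1)) => k) x :=
      fun k => differentiableAt_const k
    have dA := (dk (-(1/2))).fun_mul dws
    have dB := (dk c).fun_mul d1
    rw [pd_add' i (dh.fun_mul (d2.fun_mul (dp i))) ((dA.fun_add dB).fun_mul (dc i)),
      pd_mul' i dh (d2.fun_mul (dp i)), pd_mul' i (dA.fun_add dB) (dc i), pd_add' i dA dB,
      pd_mul' i (dk _) dws, pd_mul' i (dk _) d1, pd_mul' i d2 ds, econst, econst, eh, es, e1, e2,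
      pd_coord]
    simp only [if_true]
    ring
  simp_rw [eV]
  unfold divW
  have X1 : ∑ i, (∑ j, x j * pd (m+1) (pd (m+1) u j) i x) * pd (m+1) u i x
      = ∑ i, (∑ j, pd (m+1) u j x * pd (m+1) (pd (m+1) u i) j x) * x i := by
    simp_rw [Finset.sum_mul]
    rw [Finset.sum_comm]
    refine Finset.sum_congr rfl fun j _ => Finset.sum_congr rfl fun i _ => ?_
    ring
  have X2 : ∑ i, (if Fin.last m = i then (1:ℝ) else 0) * x i = x (Fin.last m) := by simp
  have X3 : (∑ i : Fin (m+1), (1:ℝ)) = (m:ℝ) + 1 := by simp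
  have Y : ∀ (w s h r k l : ℝ) (P g D δ Q y : Fin (m+1) → ℝ) , ∑ i,
      ((g i + P i) * (w * g i) + h * D i + (-(1/2) * (r * δ i * s + w * (2 * Q i)) + c * (k * g i)) * y i
       + l) = w * (∑ i, g i * g i) + w * (∑ i, P i * g i) + h * ∑ i, D i - (1/2) * r * s * (∑ i, δ i * y i)
       - w * (∑ i, Q i * y i) + c * k * (∑ i, y i * g i) + l * ∑ i : Fin (m+1), (1:ℝ) := by
    intro w s h r k l P g D δ Q y
    simp only [Finset.mul_sum, ← Finset.sum_add_distrib, ← Finset.sum_sub_distrib]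
    refine Finset.sum_congr rfl fun i _ => ?_
    ring
  rw [Y, X1, X2, X3]
  ring

/-- A `C^1` cutoff profile. -/
structure IsCut (χ : ℝ → ℝ) (K : ℝ) : Prop where
  smooth : ContDiff ℝ 1 χ
  bdd : ∀ s, |χ s| ≤ 1
  one : ∀ s ≤ 1, χ s = 1
  zero : ∀ s, 2 ≤ s → χ s = 0
  der : ∀ s < 1, deriv χ s = 0
  bddK : ∀ s, |s * deriv χ s| ≤ K

theorem exists_cut : ∃ χ : ℝ → ℝ, ∃ K : ℝ, IsCut χ K := by
  have hs : ContDiff ℝ 1 (fun s : ℝ => Real.smoothTransition (2 - s)) :=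
    (Real.smoothTransition.contDiff (n := 1)).comp (contDiff_const.sub contDiff_id)
  have hone : ∀ s ≤ (1:ℝ), Real.smoothTransition (2 - s) = 1 := fun s h =>
    Real.smoothTransition.one_of_one_le (by linarith)
  have hzero : ∀ s, (2:ℝ) ≤ s → Real.smoothTransition (2 - s) = 0 := fun s h =>
    Real.smoothTransition.zero_of_nonpos (by linarith)
  have hd1 : ∀ s < (1:ℝ), deriv (fun s : ℝ => Real.smoothTransition (2 - s)) s = 0 := by
    intro s hs
    have : (fun s : ℝ => Real.smoothTransition (2 - s)) =ᶠ[𝓝 s] fun _ => 1 := by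
      filter_upwards [Iio_mem_nhds hs] with z hz using hone z (le_of_lt hz)
    rw [this.deriv_eq]; simp
  have hd2 : ∀ s > (2:ℝ), deriv (fun s : ℝ => Real.smoothTransition (2 - s)) s = 0 := by
    intro s hs
    have : (fun s : ℝ => Real.smoothTransition (2 - s)) =ᶠ[𝓝 s] fun _ => 0 := by
      filter_upwards [Ioi_mem_nhds hs] with z hz using hzero z (le_of_lt hz)
    rw [this.deriv_eq]; simp
  have hcont : Continuous fun s : ℝ => s * deriv (fun s : ℝ => Real.smoothTransition (2 - s)) s :=
    continuous_id.mul (hs.continuous_deriv le_rfl)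
  obtain ⟨K, hK⟩ := (isCompact_Icc (a := (1:ℝ)) (b := 2)).exists_bound_of_continuousOn
    hcont.continuousOn
  refine ⟨_, K, hs, fun s => ?_, hone, hzero, hd1, fun s => ?_⟩
  · rw [abs_of_nonneg (Real.smoothTransition.nonneg _)]
    exact Real.smoothTransition.le_one _
  · have hK0 : 0 ≤ K := (norm_nonneg _).trans (hK 1 (by simp))
    by_cases h1 : s < 1
    · rw [hd1 s h1]; simpa using hK0
    by_cases h2 : 2 < s
    · rw [hd2 s h2]; simpa using hK0
    exact hK s ⟨not_lt.1 h1, not_lt.1 h2⟩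

/-- The radial cutoff. -/
def phi (n : ℕ) (χ : ℝ → ℝ) (t : ℝ) (x : EuclideanSpace ℝ (Fin n)) : ℝ := χ (t * ‖x‖ ^ 2)

theorem phi_contDiff {n : ℕ} {χ : ℝ → ℝ} {K : ℝ} (h : IsCut χ K) (t : ℝ) :
    ContDiff ℝ 1 (phi n χ t) :=
  h.smooth.comp (contDiff_const.mul (contDiff_norm_sq ℝ))

theorem phi_pd {n : ℕ} {χ : ℝ → ℝ} {K : ℝ} (h : IsCut χ K) (t : ℝ) (i : Fin n)
    (x : EuclideanSpace ℝ (Fin n)) :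
    pd n (phi n χ t) i x = deriv χ (t * ‖x‖ ^ 2) * (t * (2 * x i)) := by
  have hd : ContDiff ℝ 1 (fun x : EuclideanSpace ℝ (Fin n) => t * ‖x‖ ^ 2) :=
    contDiff_const.mul (contDiff_norm_sq ℝ)
  have h1 : pd n (phi n χ t) i x
      = deriv χ (t * ‖x‖ ^ 2) * pd n (fun x : EuclideanSpace ℝ (Fin n) => t * ‖x‖ ^ 2) i x :=
    pd_comp i (h.smooth.differentiable one_ne_zero _).hasDerivAt (hd.differentiable one_ne_zero x)
  rw [h1]
  congr 1
  have h2 := ((hasStrictFDerivAt_norm_sq x).hasFDerivAt.const_mul t).fderiv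
  unfold pd
  rw [h2]
  have h3 : inner ℝ x (EuclideanSpace.single i (1:ℝ)) = x i := by
    rw [real_inner_comm, EuclideanSpace.inner_single_left]; simp
  simp [h3]

theorem phi_compact {n : ℕ} {χ : ℝ → ℝ} {K : ℝ} (h : IsCut χ K) {t : ℝ} (ht : 0 < t) :
    HasCompactSupport (phi n χ t) := by
  refine HasCompactSupport.of_support_subset_isCompact
    (isCompact_closedBall (0 : EuclideanSpace ℝ (Fin n)) (2 / t + 1)) ?_
  intro x hx
  rw [mem_closedBall_zero_iff]
  by_contra hcon
  push Not at hcon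
  apply hx
  apply h.zero
  have h0 : 0 < 2 / t := by positivity
  have h1 : 2 / t ≤ ‖x‖ ^ 2 := by nlinarith
  calc (2:ℝ) = t * (2 / t) := by field_simp
    _ ≤ _ := by gcongr

theorem tend_t (r : ℝ) : ∀ᶠ k : ℕ in atTop, (1 / ((k:ℝ) + 1)) * r < 1 := by
  have h : Tendsto (fun k : ℕ => (1 / ((k:ℝ) + 1)) * r) atTop (𝓝 (0 * r)) :=
    tendsto_one_div_add_atTop_nhds_zero_nat.mul_const r
  rw [zero_mul] at h
  exact h.eventually (Iio_mem_nhds one_pos)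

theorem tend_phi {n : ℕ} {χ : ℝ → ℝ} {K : ℝ} (h : IsCut χ K)
    (μ : Measure (EuclideanSpace ℝ (Fin n))) {f : EuclideanSpace ℝ (Fin n) → ℝ}
    (hf : Integrable f μ) :
    Tendsto (fun k : ℕ => ∫ x, phi n χ (1 / ((k:ℝ) + 1)) x * f x ∂μ) atTop (𝓝 (∫ x, f x ∂μ)) := by
  refine tendsto_integral_of_dominated_convergence (fun x => ‖f x‖) (fun k => ?_) hf.norm
    (fun k => Eventually.of_forall fun x => ?_) (Eventually.of_forall fun x => ?_)
  · exact (phi_contDiff h _).continuous.aestronglyMeasurable.mul hf.aestronglyMeasurable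
  · rw [norm_mul]
    have : ‖phi n χ (1 / ((k:ℝ) + 1)) x‖ ≤ 1 := h.bdd _
    nlinarith [norm_nonneg (f x)]
  · apply tendsto_const_nhds.congr'
    filter_upwards [tend_t (‖x‖ ^ 2)] with k hk
    rw [phi, h.one _ hk.le, one_mul]

theorem int_phi {n : ℕ} {χ : ℝ → ℝ} {K : ℝ} (h : IsCut χ K) (t : ℝ)
    (μ : Measure (EuclideanSpace ℝ (Fin n))) {f : EuclideanSpace ℝ (Fin n) → ℝ}
    (hf : Integrable f μ) : Integrable (fun x => phi n χ t x * f x) μ := by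
  refine hf.norm.mono' ((phi_contDiff h _).continuous.aestronglyMeasurable.mul
    hf.aestronglyMeasurable) (Eventually.of_forall fun x => ?_)
  rw [norm_mul]
  have : ‖phi n χ t x‖ ≤ 1 := h.bdd _
  nlinarith [norm_nonneg (f x)]

theorem W_bound {n : ℕ} {χ : ℝ → ℝ} {K : ℝ} (h : IsCut χ K) {t : ℝ} (ht : 0 < t)
    {x : EuclideanSpace ℝ (Fin n)} {w r : ℝ} (hr : 0 ≤ r) (hw : |w| ≤ ‖x‖ ^ 2 * r) :
    ‖deriv χ (t * ‖x‖ ^ 2) * t * w‖ ≤ K * r := by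
  rw [norm_mul, norm_mul, Real.norm_eq_abs, Real.norm_eq_abs, Real.norm_eq_abs, abs_of_pos ht]
  have hK : 0 ≤ K := (abs_nonneg _).trans (h.bddK 0)
  by_cases hx : x = 0
  · subst hx
    have : w = 0 := by simpa using hw
    rw [this]
    simp
    positivity
  have h1 := h.bddK (t * ‖x‖ ^ 2)
  rw [abs_mul, abs_of_nonneg (by positivity : 0 ≤ t * ‖x‖ ^ 2)] at h1
  calc |deriv χ (t * ‖x‖ ^ 2)| * t * |w| ≤ |deriv χ (t * ‖x‖ ^ 2)| * t * (‖x‖ ^ 2 * r) := by gcongr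
    _ = (t * ‖x‖ ^ 2 * |deriv χ (t * ‖x‖ ^ 2)|) * r := by ring
    _ ≤ K * r := by gcongr

theorem W_meas {n : ℕ} {χ : ℝ → ℝ} {K : ℝ} (h : IsCut χ K) (t : ℝ)
    {W : EuclideanSpace ℝ (Fin n) → ℝ} (hW : Continuous W) :
    Continuous (fun x => deriv χ (t * ‖x‖ ^ 2) * t * W x) :=
  (((h.smooth.continuous_deriv le_rfl).comp (by fun_prop : Continuous fun
    x : EuclideanSpace ℝ (Fin n) => t * ‖x‖ ^ 2)).mul continuous_const).mul hW

theorem int_W {n : ℕ} {χ : ℝ → ℝ} {K : ℝ} (h : IsCut χ K) {t : ℝ} (ht : 0 < t)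
    (μ : Measure (EuclideanSpace ℝ (Fin n))) {W f : EuclideanSpace ℝ (Fin n) → ℝ}
    (hf : Integrable f μ) (hW : Continuous W) (hb : ∀ᵐ x ∂μ, 0 ≤ f x ∧ |W x| ≤ ‖x‖ ^ 2 * f x) :
    Integrable (fun x => deriv χ (t * ‖x‖ ^ 2) * t * W x) μ := by
  refine (hf.const_mul K).mono' (W_meas h t hW).aestronglyMeasurable ?_
  filter_upwards [hb] with x hx using W_bound h ht hx.1 hx.2

theorem tend_W {n : ℕ} {χ : ℝ → ℝ} {K : ℝ} (h : IsCut χ K)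
    (μ : Measure (EuclideanSpace ℝ (Fin n))) {W f : EuclideanSpace ℝ (Fin n) → ℝ}
    (hf : Integrable f μ) (hW : Continuous W) (hb : ∀ᵐ x ∂μ, 0 ≤ f x ∧ |W x| ≤ ‖x‖ ^ 2 * f x) :
    Tendsto (fun k : ℕ => ∫ x, deriv χ ((1 / ((k:ℝ) + 1)) * ‖x‖ ^ 2) * (1 / ((k:ℝ) + 1)) * W x ∂μ)
      atTop (𝓝 0) := by
  rw [← integral_zero (EuclideanSpace ℝ (Fin n)) ℝ (μ := μ)]
  refine tendsto_integral_of_dominated_convergence (fun x => K * f x)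
    (fun k => (W_meas h _ hW).aestronglyMeasurable) (hf.const_mul K)
    (fun k => ?_) (Eventually.of_forall fun x => ?_)
  · filter_upwards [hb] with x hx using W_bound h (by positivity) hx.1 hx.2
  · apply tendsto_const_nhds.congr'
    filter_upwards [tend_t (‖x‖ ^ 2)] with k hk
    rw [h.der _ hk]; simp

theorem bdry_parts {m : ℕ} {φ v : EuclideanSpace ℝ (Fin m) → ℝ} (hφ : ContDiff ℝ 1 φ)
    (hc : HasCompactSupport φ) (hv : ContDiff ℝ 1 v) :
    ∫ y, φ y * ∑ j, y j * pd m v j y = - ∫ y, ((m:ℝ) * φ y + ∑ j, y j * pd m φ j y) * v y := by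
  have hcj : ∀ j, ContDiff ℝ 1 (fun y : EuclideanSpace ℝ (Fin m) => φ y * y j) := fun j =>
    hφ.mul (contDiff_coord j)
  have hcc : ∀ j, HasCompactSupport (fun y : EuclideanSpace ℝ (Fin m) => φ y * y j) := fun j =>
    hc.mul_right
  have hpc : ∀ j, HasCompactSupport (pd m (fun y : EuclideanSpace ℝ (Fin m) => φ y * y j) j) :=
    fun j => (hcc j).fderiv_apply ℝ _
  have i1 : ∀ j, Integrable (fun y => pd m (fun y : EuclideanSpace ℝ (Fin m) => φ y * y j) j y * v y) :=
    fun j => ((continuous_pd (hcj j) j).mul hv.continuous).integrable_of_hasCompactSupport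
      (hpc j).mul_right
  have i2 : ∀ j, Integrable (fun y => (φ y * y j) * pd m v j y) :=
    fun j => ((hcj j).continuous.mul (continuous_pd hv j)).integrable_of_hasCompactSupport
      (hcc j).mul_right
  have i3 : ∀ j, Integrable (fun y : EuclideanSpace ℝ (Fin m) => (φ y * y j) * v y) :=
    fun j => ((hcj j).continuous.mul hv.continuous).integrable_of_hasCompactSupport
      (hcc j).mul_right
  have key : ∀ j, ∫ y, (φ y * y j) * pd m v j y
      = - ∫ y, pd m (fun y : EuclideanSpace ℝ (Fin m) => φ y * y j) j y * v y := fun j =>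
    integral_mul_fderiv_eq_neg_fderiv_mul_of_integrable (i1 j) (i2 j) (i3 j)
      (fun x _ => (hcj j).differentiable one_ne_zero x)
      (fun x _ => hv.differentiable one_ne_zero x)
  have e1 : ∀ y, φ y * ∑ j, y j * pd m v j y = ∑ j, (φ y * y j) * pd m v j y := fun y => by
    rw [Finset.mul_sum]; exact Finset.sum_congr rfl fun j _ => by ring
  have e2 : ∀ y : EuclideanSpace ℝ (Fin m), ((m:ℝ) * φ y + ∑ j, y j * pd m φ j y) * v y
      = ∑ j, pd m (fun y : EuclideanSpace ℝ (Fin m) => φ y * y j) j y * v y := fun y => by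
    rw [← Finset.sum_mul]
    congr 1
    have : ∀ j, pd m (fun y : EuclideanSpace ℝ (Fin m) => φ y * y j) j y
        = y j * pd m φ j y + φ y := fun j => by
      rw [pd_mul' j (hφ.differentiable one_ne_zero y)
        ((contDiff_coord (k := 1) j).differentiable one_ne_zero y), pd_coord]
      simp
      ring
    simp_rw [this, Finset.sum_add_distrib]
    simp
    ring
  simp_rw [e1, e2]
  rw [integral_finsetSum _ (fun j _ => i2 j), integral_finsetSum _ (fun j _ => i1 j),
    ← Finset.sum_neg_distrib]
  exact Finset.sum_congr rfl fun j _ => key j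

theorem mkPt_castSucc {m : ℕ} (y : EuclideanSpace ℝ (Fin m)) (t : ℝ) (j : Fin m) :
    mkPt (m+1) y t j.castSucc = y j := by
  simp [mkPt]

theorem mkPt_last {m : ℕ} (y : EuclideanSpace ℝ (Fin m)) (t : ℝ) :
    mkPt (m+1) y t (Fin.last m) = t := by
  simp [mkPt]

/-- The boundary embedding as a continuous linear map. -/
def Lb (m : ℕ) : EuclideanSpace ℝ (Fin m) →L[ℝ] EuclideanSpace ℝ (Fin (m+1)) :=
  LinearMap.toContinuousLinearMap
    { toFun := fun y => mkPt (m+1) y 0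
      map_add' := fun y z => by
        ext i
        refine Fin.lastCases ?_ (fun j => ?_) i
        · simp [mkPt_last]
        · simp [mkPt_castSucc]
      map_smul' := fun c y => by
        ext i
        refine Fin.lastCases ?_ (fun j => ?_) i
        · simp [mkPt_last]
        · simp [mkPt_castSucc] }

theorem Lb_apply (m : ℕ) (y : EuclideanSpace ℝ (Fin m)) : Lb m y = mkPt (m+1) y 0 := rfl

theorem norm_mkPt {m : ℕ} (y : EuclideanSpace ℝ (Fin m)) : ‖mkPt (m+1) y 0‖ ^ 2 = ‖y‖ ^ 2 := by
  rw [EuclideanSpace.real_norm_sq_eq, EuclideanSpace.real_norm_sq_eq, Fin.sum_univ_castSucc]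
  simp [mkPt_last, mkPt_castSucc]

theorem pd_Lb {m : ℕ} {u : EuclideanSpace ℝ (Fin (m+1)) → ℝ} (hu : ContDiff ℝ 1 u) (j : Fin m)
    (y : EuclideanSpace ℝ (Fin m)) :
    pd m (fun y => u (mkPt (m+1) y 0)) j y = pd (m+1) u j.castSucc (mkPt (m+1) y 0) := by
  have h : fderiv ℝ (u ∘ Lb m) y = (fderiv ℝ u (Lb m y)).comp (Lb m) := by
    rw [fderiv_comp _ (hu.differentiable one_ne_zero _) (Lb m).differentiableAt, (Lb m).fderiv]
  have h2 : Lb m (EuclideanSpace.single j 1) = EuclideanSpace.single j.castSucc 1 := by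
    ext i
    refine Fin.lastCases ?_ (fun k => ?_) i
    · simp [Lb_apply, mkPt_last, Fin.castSucc_ne_last]
    · simp [Lb_apply, mkPt_castSucc, Fin.castSucc_inj]
  change fderiv ℝ (u ∘ Lb m) y _ = _
  rw [h, ContinuousLinearMap.comp_apply, h2]
  rfl

theorem poho (m : ℕ) (hm : 2 ≤ m) (ρ : ℝ → ℝ) (hρ : ContDiff ℝ 1 ρ) (hρ0 : ρ 0 = 1)
    (hρpos : ∀ s, 0 < s → 0 < ρ s) (c₁ : ℝ)
    (hρ1 : ∀ s : ℝ, 0 < s → 0 < deriv ρ s * s ∧ deriv ρ s * s ≤ c₁ * ρ s)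
    (a b p q : ℝ) (ha : 0 < a)
    (hp : p = 2 * ((m:ℝ)+1) / ((m:ℝ)-1)) (hq : q = 2 * (m:ℝ) / ((m:ℝ)-1))
    (u : EuclideanSpace ℝ (Fin (m+1)) → ℝ) (hu : ContDiff ℝ 2 u)
    (hPDE : ∀ x : EuclideanSpace ℝ (Fin (m+1)), 0 < x (Fin.last m) →
      -divW (m+1) (fun z => ρ (z (Fin.last m))) u x = a * |u x| ^ (p - 2) * u x)
    (hBC : ∀ y : EuclideanSpace ℝ (Fin m), -pd (m+1) u (Fin.last m) (mkPt (m+1) y 0) =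
      b * |u (mkPt (m+1) y 0)| ^ (q - 2) * u (mkPt (m+1) y 0))
    (hE : IntegrableOn (fun x => ρ (x (Fin.last m)) * ∑ j, pd (m+1) u j x * pd (m+1) u j x)
      {x | 0 < x (Fin.last m)})
    (hP : IntegrableOn (fun x => |u x| ^ p) {x | 0 < x (Fin.last m)})
    (hQ : Integrable (fun y : EuclideanSpace ℝ (Fin m) => |u (mkPt (m+1) y 0)| ^ q)) :
    IntegrableOn (fun x => (deriv ρ (x (Fin.last m)) * x (Fin.last m)) *
        ∑ j, pd (m+1) u j x * pd (m+1) u j x) {x | 0 < x (Fin.last m)} ∧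
    (-(((m:ℝ)-1)/2) * (∫ x in {x : EuclideanSpace ℝ (Fin (m+1)) | 0 < x (Fin.last m)},
        ρ (x (Fin.last m)) * ∑ j, pd (m+1) u j x * pd (m+1) u j x)
      - (1/2) * (∫ x in {x : EuclideanSpace ℝ (Fin (m+1)) | 0 < x (Fin.last m)},
        (deriv ρ (x (Fin.last m)) * x (Fin.last m)) * ∑ j, pd (m+1) u j x * pd (m+1) u j x)
      + a * (((m:ℝ)-1)/2) * (∫ x in {x : EuclideanSpace ℝ (Fin (m+1)) | 0 < x (Fin.last m)},
        |u x| ^ p)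
      = -(b * (((m:ℝ)-1)/2)) * ∫ y : EuclideanSpace ℝ (Fin m), |u (mkPt (m+1) y 0)| ^ q) := by
  have hm' : (2:ℝ) ≤ m := by exact_mod_cast hm
  have hm1 : (0:ℝ) < (m:ℝ) - 1 := by linarith
  have hp1 : 1 < p := by rw [hp, lt_div_iff₀ hm1]; linarith
  have hq1 : 1 < q := by rw [hq, lt_div_iff₀ hm1]; linarith
  have hu1 : ContDiff ℝ 1 u := hu.of_le (by norm_num)
  set S : Set (EuclideanSpace ℝ (Fin (m+1))) := {x | 0 < x (Fin.last m)} with hS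
  have hSm : MeasurableSet S :=
    measurableSet_lt measurable_const (contDiff_coord (k := 0) (Fin.last m)).continuous.measurable
  set w : EuclideanSpace ℝ (Fin (m+1)) → ℝ := fun x => ρ (x (Fin.last m)) with hw
  set s : EuclideanSpace ℝ (Fin (m+1)) → ℝ := fun x => ∑ j, pd (m+1) u j x * pd (m+1) u j x with hs
  set h : EuclideanSpace ℝ (Fin (m+1)) → ℝ := fun x => ∑ j, x j * pd (m+1) u j x with hh
  have s0 : ∀ x, 0 ≤ s x := fun x => Finset.sum_nonneg fun j _ => mul_self_nonneg _
  have ccoord : ∀ j, Continuous fun x : EuclideanSpace ℝ (Fin (m+1)) => x j := fun j =>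
    (contDiff_coord (k := 0) j).continuous
  have cs : Continuous s := continuous_finsetSum _ fun j _ =>
    (continuous_pd hu1 j).mul (continuous_pd hu1 j)
  have ch : Continuous h := continuous_finsetSum _ fun j _ =>
    (ccoord j).mul (continuous_pd hu1 j)
  have cw : Continuous w := hρ.continuous.comp (ccoord _)
  have cP : Continuous (fun x => |u x| ^ p) := (hu1.norm_rpow hp1).continuous
  have cr : Continuous (fun x : EuclideanSpace ℝ (Fin (m+1)) =>
      (deriv ρ (x (Fin.last m)) * x (Fin.last m)) * s x) :=
    (((hρ.continuous_deriv le_rfl).comp (ccoord _)).mul (ccoord _)).mul cs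
  have hR : IntegrableOn (fun x => (deriv ρ (x (Fin.last m)) * x (Fin.last m)) * s x) S := by
    refine Integrable.mono' (hE.const_mul c₁) cr.aestronglyMeasurable ?_
    filter_upwards [ae_restrict_mem hSm] with x hx
    have h1 := hρ1 _ hx
    rw [Real.norm_eq_abs, abs_of_nonneg (mul_nonneg h1.1.le (s0 x)), ← mul_assoc]
    exact mul_le_mul_of_nonneg_right h1.2 (s0 x)
  refine ⟨hR, ?_⟩
  obtain ⟨χ, K, hχ⟩ := exists_cut
  have hp0 : p ≠ 0 := by linarith
  have hq0 : q ≠ 0 := by linarith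
  set V := Vf m ρ (a/p) p u with hV
  have cV := contDiff_Vf m ρ hρ (a/p) p hp1 u hu
  set D : EuclideanSpace ℝ (Fin (m+1)) → ℝ := fun x =>
    -(((m:ℝ)-1)/2) * (w x * s x) - (1/2) * ((deriv ρ (x (Fin.last m)) * x (Fin.last m)) * s x)
      + a * (((m:ℝ)-1)/2) * |u x| ^ p with hD
  have iD : IntegrableOn D S := ((hE.const_mul _).sub (hR.const_mul _)).add (hP.const_mul _)
  have hdivV : ∀ x ∈ S, ∑ i, pd (m+1) (V i) i x = D x := by
    intro x hx
    rw [hV, div_Vf m ρ hρ (a/p) p hp1 u hu x]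
    have e := hPDE x hx
    have e' : divW (m+1) (fun z => ρ (z (Fin.last m))) u x = -(a * |u x| ^ (p - 2) * u x) := by
      linarith
    rw [e']
    have e2 : a / p * p = a := by field_simp
    have e3 : a / p * ((m:ℝ)+1) = a * (((m:ℝ)-1)/2) := by rw [hp]; field_simp
    rw [e2, e3]
    simp only [hD, hw, hs]
    ring
  set W : EuclideanSpace ℝ (Fin (m+1)) → ℝ := fun x =>
    w x * h x ^ 2 - (1/2) * (w x * s x) * ‖x‖ ^ 2 + a / p * |u x| ^ p * ‖x‖ ^ 2 with hW
  have cW : Continuous W := by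
    have cn : Continuous fun x : EuclideanSpace ℝ (Fin (m+1)) => ‖x‖ ^ 2 := by fun_prop
    exact ((cw.mul (ch.pow 2)).sub ((continuous_const.mul (cw.mul cs)).mul cn)).add
      ((continuous_const.mul cP).mul cn)
  have hgV : ∀ t x, ∑ i, pd (m+1) (phi (m+1) χ t) i x * V i x
      = 2 * (deriv χ (t * ‖x‖ ^ 2) * t * W x) := by
    intro t x
    simp_rw [phi_pd hχ]
    have e1 : ∑ i, x i * V i x = W x := by
      simp only [hV, Vf, hW, hh, hs, hw, EuclideanSpace.real_norm_sq_eq]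
      have : ∀ (h w k : ℝ) (g : Fin (m+1) → ℝ), ∑ i, x i * (h * (w * g i) + k * x i)
          = h * w * (∑ i, x i * g i) + k * ∑ i, x i ^ 2 := by
        intro h w k g
        simp only [Finset.mul_sum, ← Finset.sum_add_distrib]
        exact Finset.sum_congr rfl fun i _ => by ring
      rw [this]
      ring
    rw [← e1, Finset.mul_sum, Finset.mul_sum]
    exact Finset.sum_congr rfl fun i _ => by ring
  have hWb : ∀ᵐ x ∂(volume.restrict S), 0 ≤ (w x * s x + a / p * |u x| ^ p) ∧
      |W x| ≤ ‖x‖ ^ 2 * (w x * s x + a / p * |u x| ^ p) := by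
    filter_upwards [ae_restrict_mem hSm] with x hx
    have w0 : 0 ≤ w x := (hρpos _ hx).le
    have u0 : 0 ≤ a / p * |u x| ^ p := by positivity
    have ws0 : 0 ≤ w x * s x := mul_nonneg w0 (s0 x)
    have hCS : h x ^ 2 ≤ ‖x‖ ^ 2 * s x := by
      have := Finset.sum_mul_sq_le_sq_mul_sq Finset.univ (fun j => x j) (fun j => pd (m+1) u j x)
      rw [EuclideanSpace.real_norm_sq_eq]
      simpa only [hh, hs, pow_two] using this
    refine ⟨by positivity, ?_⟩
    have n0 : 0 ≤ ‖x‖ ^ 2 := by positivity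
    have hA : w x * h x ^ 2 ≤ w x * (‖x‖ ^ 2 * s x) := mul_le_mul_of_nonneg_left hCS w0
    have hA0 : 0 ≤ w x * h x ^ 2 := by positivity
    have hB0 : 0 ≤ (w x * s x) * ‖x‖ ^ 2 := by positivity
    have hC0 : 0 ≤ a / p * |u x| ^ p * ‖x‖ ^ 2 := by positivity
    rw [abs_le]
    simp only [hW]
    constructor <;> nlinarith
  have iF : IntegrableOn (fun x => w x * s x + a / p * |u x| ^ p) S := hE.add (hP.const_mul _)
  -- boundary function
  set v : EuclideanSpace ℝ (Fin m) → ℝ := fun y => |u (mkPt (m+1) y 0)| ^ q with hv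
  have cub : ContDiff ℝ 1 (fun y => u (mkPt (m+1) y 0)) := hu1.comp (Lb m).contDiff
  have cv : ContDiff ℝ 1 v := cub.norm_rpow hq1
  have hVb : ∀ y : EuclideanSpace ℝ (Fin m), V (Fin.last m) (mkPt (m+1) y 0) = -(b/q) * ∑ j, y j * pd m v j y := by
    intro y
    have e1 : ∀ j, pd m v j y = q * |u (mkPt (m+1) y 0)| ^ (q-2) * u (mkPt (m+1) y 0)
        * pd (m+1) u j.castSucc (mkPt (m+1) y 0) := fun j => by
      rw [← pd_Lb hu1]
      exact pd_comp j (f := fun y => u (mkPt (m+1) y 0)) (hasDerivAt_abs_rpow _ hq1)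
        (cub.differentiable one_ne_zero y)
    have e2 : pd (m+1) u (Fin.last m) (mkPt (m+1) y 0) = -(b * |u (mkPt (m+1) y 0)| ^ (q - 2)
        * u (mkPt (m+1) y 0)) := by linarith [hBC y]
    simp only [hV, Vf, mkPt_last, hρ0, e2, Fin.sum_univ_castSucc, mkPt_castSucc, e1]
    rw [zero_mul, add_zero, mul_zero, add_zero, one_mul, Finset.sum_mul, Finset.mul_sum]
    refine Finset.sum_congr rfl fun j _ => ?_
    field_simp
  have hid : ∀ t : ℝ, 0 < t → 2 * (∫ x in S, deriv χ (t * ‖x‖ ^ 2) * t * W x)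
      + ∫ x in S, phi (m+1) χ t x * D x
      = -(b/q) * ((m:ℝ) * (∫ y, phi m χ t y * v y)
        + 2 * ∫ y, deriv χ (t * ‖y‖ ^ 2) * t * (‖y‖ ^ 2 * v y)) := by
    intro t ht
    have hφ := phi_contDiff (n := m+1) hχ t
    have H := half_div m (fun i z => phi (m+1) χ t z * V i z) (fun i => hφ.mul (cV i))
      (fun i => (phi_compact hχ ht).mul_right)
    have eL : ∫ x in S, ∑ i, pd (m+1) (fun z => phi (m+1) χ t z * V i z) i x
        = 2 * (∫ x in S, deriv χ (t * ‖x‖ ^ 2) * t * W x) + ∫ x in S, phi (m+1) χ t x * D x := by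
      rw [← integral_const_mul, ← integral_add ((int_W hχ ht _ iF cW hWb).const_mul 2)
        (int_phi hχ t _ iD)]
      refine setIntegral_congr_fun hSm fun x hx => ?_
      rw [← hgV, ← hdivV x hx, Finset.mul_sum, ← Finset.sum_add_distrib]
      exact Finset.sum_congr rfl fun i _ => pd_mul' i (hφ.differentiable one_ne_zero x)
        ((cV i).differentiable one_ne_zero x)
    rw [← eL, H]
    have hφ' := phi_contDiff (n := m) hχ t
    have eR : ∀ y : EuclideanSpace ℝ (Fin m), phi (m+1) χ t (mkPt (m+1) y 0) * V (Fin.last m) (mkPt (m+1) y 0)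
        = -(b/q) * (phi m χ t y * ∑ j, y j * pd m v j y) := by
      intro y
      rw [hVb, phi, norm_mkPt, phi]
      ring
    simp_rw [eR]
    rw [integral_const_mul, bdry_parts hφ' (phi_compact hχ ht) cv]
    have eB : ∫ y, ((m:ℝ) * phi m χ t y + ∑ j, y j * pd m (phi m χ t) j y) * v y
        = (m:ℝ) * (∫ y, phi m χ t y * v y)
        + 2 * ∫ y, deriv χ (t * ‖y‖ ^ 2) * t * (‖y‖ ^ 2 * v y) := by
      have hb : ∀ᵐ y : EuclideanSpace ℝ (Fin m), 0 ≤ v y ∧ |‖y‖ ^ 2 * v y| ≤ ‖y‖ ^ 2 * v y := by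
        refine Eventually.of_forall fun y => ⟨by positivity, ?_⟩
        rw [abs_of_nonneg (by positivity)]
      have j1 : Integrable (fun y => (m:ℝ) * (phi m χ t y * v y)) := (int_phi hχ t _ hQ).const_mul _
      have j2 : Integrable (fun y : EuclideanSpace ℝ (Fin m) =>
          2 * (deriv χ (t * ‖y‖ ^ 2) * t * (‖y‖ ^ 2 * v y))) :=
        (int_W hχ ht volume hQ ((continuous_norm.pow 2).mul cv.continuous) hb).const_mul 2
      rw [← integral_const_mul, ← integral_const_mul, ← integral_add j1 j2]
      · refine integral_congr_ae (Eventually.of_forall fun y => ?_)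
        simp only [phi_pd hχ]
        have : ∑ j, y j * (deriv χ (t * ‖y‖ ^ 2) * (t * (2 * y j)))
            = 2 * (deriv χ (t * ‖y‖ ^ 2) * t) * ‖y‖ ^ 2 := by
          generalize deriv χ (t * ‖y‖ ^ 2) = d
          rw [EuclideanSpace.real_norm_sq_eq y, Finset.mul_sum]
          exact Finset.sum_congr rfl fun j _ => by ring
        rw [this]
        ring
    rw [eB]
    ring
  have T1 := tend_W hχ _ iF cW hWb
  have T2 := tend_phi hχ _ iD
  have T3 := tend_phi hχ _ hQ
  have T4 := tend_W hχ volume (W := fun y => ‖y‖ ^ 2 * v y) (f := v) hQ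
    ((continuous_norm.pow 2).mul cv.continuous) (Eventually.of_forall fun y => ⟨by positivity, by
      rw [abs_of_nonneg (by positivity)]⟩)
  have TL := (T1.const_mul 2).add T2
  have TR := ((T3.const_mul (m:ℝ)).add (T4.const_mul 2)).const_mul (-(b/q))
  have hlim := tendsto_nhds_unique (TL.congr fun k => hid _ (by positivity)) TR
  have eD : ∫ x in S, D x = -(((m:ℝ)-1)/2) * (∫ x in S, w x * s x)
      - (1/2) * (∫ x in S, (deriv ρ (x (Fin.last m)) * x (Fin.last m)) * s x)
      + a * (((m:ℝ)-1)/2) * (∫ x in S, |u x| ^ p) := by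
    simp only [hD]
    have hE' : Integrable (fun x => -(((m:ℝ)-1)/2) * (w x * s x)) (volume.restrict S) :=
      hE.const_mul _
    have hR' : Integrable (fun x => (1/2) * ((deriv ρ (x (Fin.last m)) * x (Fin.last m)) * s x))
      (volume.restrict S) := hR.const_mul _
    have hER : Integrable (fun x => -(((m:ℝ)-1)/2) * (w x * s x)
      - (1/2) * ((deriv ρ (x (Fin.last m)) * x (Fin.last m)) * s x)) (volume.restrict S) :=
      hE'.sub hR'
    rw [integral_add hER (hP.const_mul _), integral_sub hE' hR', integral_const_mul, integral_const_mul,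
      integral_const_mul]
  rw [← eD]
  have e4 : b / q * m = b * (((m:ℝ)-1)/2) := by rw [hq]; field_simp
  rw [← e4]
  linarith

theorem norm_grad_sq {n : ℕ} (u : EuclideanSpace ℝ (Fin n) → ℝ) (x : EuclideanSpace ℝ (Fin n)) :
    ‖gradient u x‖ ^ 2 = ∑ j, pd n u j x * pd n u j x := by
  rw [EuclideanSpace.real_norm_sq_eq]
  refine Finset.sum_congr rfl fun j _ => ?_
  have : gradient u x j = pd n u j x := by
    have h : inner ℝ (gradient u x) (EuclideanSpace.single j (1:ℝ)) = pd n u j x := by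
      unfold gradient pd
      rw [InnerProductSpace.toDual_symm_apply]
    rw [← h, real_inner_comm, EuclideanSpace.inner_single_left]
    simp
  rw [this, pow_two]

theorem fderiv_zero_of_pd {n : ℕ} (u : EuclideanSpace ℝ (Fin n) → ℝ) (x : EuclideanSpace ℝ (Fin n))
    (h : ∑ j, pd n u j x * pd n u j x = 0) : fderiv ℝ u x = 0 := by
  rw [← norm_grad_sq] at h
  have h2 : gradient u x = 0 := by simpa using h
  unfold gradient at h2
  simpa using h2

open scoped Pointwise in
theorem volume_half (m : ℕ) :
    volume {x : EuclideanSpace ℝ (Fin (m+1)) | 0 < x (Fin.last m)} = ⊤ := by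
  set S : Set (EuclideanSpace ℝ (Fin (m+1))) := {x | 0 < x (Fin.last m)} with hS
  have ho : IsOpen S := isOpen_lt continuous_const (contDiff_coord (k := 0) (Fin.last m)).continuous
  have hne : S.Nonempty := ⟨EuclideanSpace.single (Fin.last m) 1, by simp [hS]⟩
  have hpos := ho.measure_pos volume hne
  have h2 : (2:ℝ) • S = S := by
    ext x
    rw [Set.mem_smul_set_iff_inv_smul_mem₀ two_ne_zero]
    simp [hS]
  have h3 := Measure.addHaar_smul volume (2:ℝ) S
  rw [h2, finrank_euclideanSpace_fin] at h3
  by_contra hfin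
  have h4 : (volume S).toReal = 2 ^ (m+1) * (volume S).toReal := by
    conv_lhs => rw [h3]
    rw [ENNReal.toReal_mul, ENNReal.toReal_ofReal (abs_nonneg _), abs_of_pos (by positivity)]
  have h5 : 0 < (volume S).toReal := ENNReal.toReal_pos hpos.ne' hfin
  have h6 : (1:ℝ) < 2 ^ (m+1) := one_lt_pow₀ one_lt_two (by omega)
  nlinarith

theorem poho_zero (m : ℕ) (ρ : ℝ → ℝ) (hρ : ContDiff ℝ 1 ρ)
    (hρ1 : ∀ s : ℝ, 0 < s → 0 < deriv ρ s * s)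
    (p : ℝ) (hp0 : p ≠ 0)
    (u : EuclideanSpace ℝ (Fin (m+1)) → ℝ) (hu : ContDiff ℝ 2 u)
    (hP : IntegrableOn (fun x => |u x| ^ p) {x | 0 < x (Fin.last m)})
    (hR : IntegrableOn (fun x => (deriv ρ (x (Fin.last m)) * x (Fin.last m)) *
        ∑ j, pd (m+1) u j x * pd (m+1) u j x) {x | 0 < x (Fin.last m)})
    (hR0 : (∫ x in {x : EuclideanSpace ℝ (Fin (m+1)) | 0 < x (Fin.last m)},
        (deriv ρ (x (Fin.last m)) * x (Fin.last m)) * ∑ j, pd (m+1) u j x * pd (m+1) u j x) = 0)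
    (x : EuclideanSpace ℝ (Fin (m+1))) (hx : 0 ≤ x (Fin.last m)) : u x = 0 := by
  have hu1 : ContDiff ℝ 1 u := hu.of_le (by norm_num)
  have ccoord : ∀ j, Continuous fun x : EuclideanSpace ℝ (Fin (m+1)) => x j := fun j =>
    (contDiff_coord (k := 0) j).continuous
  set S : Set (EuclideanSpace ℝ (Fin (m+1))) := {x | 0 < x (Fin.last m)} with hS
  have ho : IsOpen S := isOpen_lt continuous_const (ccoord _)
  have cr : Continuous (fun x : EuclideanSpace ℝ (Fin (m+1)) =>
      (deriv ρ (x (Fin.last m)) * x (Fin.last m)) * ∑ j, pd (m+1) u j x * pd (m+1) u j x) :=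
    (((hρ.continuous_deriv le_rfl).comp (ccoord _)).mul (ccoord _)).mul
      (continuous_finsetSum _ fun j _ => (continuous_pd hu1 j).mul (continuous_pd hu1 j))
  have hae := (setIntegral_eq_zero_iff_of_nonneg_ae (by
    filter_upwards [ae_restrict_mem ho.measurableSet] with z hz
    exact mul_nonneg (hρ1 _ hz).le (Finset.sum_nonneg fun j _ => mul_self_nonneg _)) hR).1 hR0
  have heq := Measure.eqOn_open_of_ae_eq hae ho cr.continuousOn continuousOn_const
  have hfd : ∀ z ∈ S, fderiv ℝ u z = 0 := fun z hz => by
    apply fderiv_zero_of_pd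
    have := heq hz
    simp only [Pi.zero_apply, mul_eq_zero] at this
    rcases this with h | h
    · exact absurd (mul_eq_zero.2 h) (hρ1 _ hz).ne'
    · exact h
  have hconv : Convex ℝ S := by
    intro y hy z hz α β hα hβ hαβ
    simp only [hS, Set.mem_ofPred_eq, PiLp.add_apply, PiLp.smul_apply, smul_eq_mul] at *
    rcases hα.eq_or_lt with h | h
    · subst h
      have : β = 1 := by linarith
      subst this; simpa using hz
    · have := mul_pos h hy
      have := mul_nonneg hβ hz.le
      linarith
  set e : EuclideanSpace ℝ (Fin (m+1)) := EuclideanSpace.single (Fin.last m) 1 with he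
  have heS : e ∈ S := by simp [hS, he]
  have hconst : ∀ z ∈ S, u z = u e := fun z hz =>
    ho.is_const_of_fderiv_eq_zero hconv.isPreconnected
      (hu1.differentiable one_ne_zero).differentiableOn hfd hz heS
  have hI : IntegrableOn (fun _ => |u e| ^ p) S :=
    hP.congr_fun (fun z hz => by simp only [hconst z hz]) ho.measurableSet
  have hz0 : u e = 0 := by
    rw [integrableOn_const_iff] at hI
    rcases hI with h | h
    · have h' := (Real.rpow_eq_zero (abs_nonneg _) hp0).1 (enorm_eq_zero.1 h)
      exact abs_eq_zero.1 h'
    · rw [volume_half] at h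
      exact absurd h (lt_irrefl _)
  have hS0 : ∀ z ∈ S, u z = 0 := fun z hz => (hconst z hz).trans hz0
  have hcl : Tendsto (fun t : ℝ => u (x + t • e)) (𝓝[>] 0) (𝓝 (u x)) := by
    have : Continuous fun t : ℝ => u (x + t • e) := hu1.continuous.comp (by fun_prop)
    have h := this.tendsto 0
    simp only [zero_smul, add_zero] at h
    exact h.mono_left nhdsWithin_le_nhds
  refine tendsto_nhds_unique hcl (tendsto_const_nhds.congr' ?_)
  filter_upwards [self_mem_nhdsWithin] with t ht
  refine (hS0 _ ?_).symm
  have ht' : (0:ℝ) < t := ht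
  simp [hS, he]
  linarith

theorem stmt13 (N : ℕ) (hN : 3 ≤ N) (ρ : ℝ → ℝ) (hρC1 : ContDiff ℝ 1 ρ)
    (hρzero : ρ 0 = 1) (γ : ℝ) (hγ : 0 < γ)
    (hρlow : ∀ s : ℝ, 0 ≤ s → (1 + s) ^ γ ≤ ρ s)
    (c₁ : ℝ) (hc₁ : 0 < c₁)
    (hρ1 : ∀ s : ℝ, 0 < s → 0 < deriv ρ s * s ∧ deriv ρ s * s ≤ c₁ * ρ s)
    (a b : ℝ) (ha : 0 < a) (hb : 0 < b)
    (u : EuclideanSpace ℝ (Fin N) → ℝ) (hu : ContDiff ℝ 2 u)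
    (hsol : IsSolutionP0 N (by omega) ρ a b (2 * (N : ℝ) / ((N : ℝ) - 2))
      (2 * ((N : ℝ) - 1) / ((N : ℝ) - 2)) u)
    (hpos : ∀ x, 0 ≤ xN N (by omega) x → 0 ≤ u x)
    (henergy : IntegrableOn (fun x => ρ (xN N (by omega) x) * ‖gradient u x‖ ^ 2)
      (Hplus N (by omega)) volume)
    (hLp : IntegrableOn (fun x => |u x| ^ (2 * (N : ℝ) / ((N : ℝ) - 2)))
      (Hplus N (by omega)) volume)
    (hLq : Integrable (fun y : EuclideanSpace ℝ (Fin (N - 1)) =>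
      |u (bPt N y)| ^ (2 * ((N : ℝ) - 1) / ((N : ℝ) - 2))))
    (hident : (∫ x in Hplus N (by omega),
        ρ (xN N (by omega) x) * ‖gradient u x‖ ^ 2) =
      a * (∫ x in Hplus N (by omega), u x ^ (2 * (N : ℝ) / ((N : ℝ) - 2))) +
        b * ∫ y : EuclideanSpace ℝ (Fin (N - 1)),
          u (bPt N y) ^ (2 * ((N : ℝ) - 1) / ((N : ℝ) - 2))) :
    ∀ x, 0 ≤ xN N (by omega) x → u x = 0 := by
  obtain ⟨m, rfl⟩ : ∃ m, N = m + 1 := ⟨N - 1, by omega⟩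
  have hc : (((m + 1 : ℕ) : ℝ)) = (m:ℝ) + 1 := by push_cast; ring
  have hm : 2 ≤ m := by omega
  have hm' : (2:ℝ) ≤ m := by exact_mod_cast hm
  have hpe : 2 * ((m + 1 : ℕ) : ℝ) / (((m + 1 : ℕ) : ℝ) - 2) = 2 * ((m:ℝ)+1) / ((m:ℝ)-1) := by
    rw [hc]; congr 1; ring
  have hqe : 2 * (((m + 1 : ℕ) : ℝ) - 1) / (((m + 1 : ℕ) : ℝ) - 2) = 2 * (m:ℝ) / ((m:ℝ)-1) := by
    rw [hc]; congr 1 <;> ring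
  rw [hpe] at hLp hident
  rw [hqe] at hLq hident
  rw [hpe, hqe] at hsol
  have hρpos : ∀ s, 0 < s → 0 < ρ s := fun s hs =>
    lt_of_lt_of_le (Real.rpow_pos_of_pos (by linarith) _) (hρlow s hs.le)
  simp only [norm_grad_sq] at henergy hident
  have hoS : IsOpen {x : EuclideanSpace ℝ (Fin (m+1)) | 0 < x (Fin.last m)} :=
    isOpen_lt continuous_const (contDiff_coord (k := 0) (Fin.last m)).continuous
  have hP := poho m hm ρ hρC1 hρzero hρpos c₁ hρ1 a b _ _ ha rfl rfl u hu hsol.1 hsol.2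
    henergy hLp hLq
  have eA : (∫ x in {x : EuclideanSpace ℝ (Fin (m+1)) | 0 < x (Fin.last m)},
      |u x| ^ (2 * ((m:ℝ)+1) / ((m:ℝ)-1))) = ∫ x in Hplus (m+1) (by omega),
      u x ^ (2 * ((m:ℝ)+1) / ((m:ℝ)-1)) :=
    setIntegral_congr_fun hoS.measurableSet fun x hx => by
      simp only [abs_of_nonneg (hpos x (le_of_lt hx))]
  have eB : (∫ y : EuclideanSpace ℝ (Fin m), |u (mkPt (m+1) y 0)| ^ (2 * (m:ℝ) / ((m:ℝ)-1)))
      = ∫ y : EuclideanSpace ℝ (Fin (m+1-1)), u (bPt (m+1) y) ^ (2 * (m:ℝ) / ((m:ℝ)-1)) :=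
    integral_congr_ae (Eventually.of_forall fun y => by
      have : 0 ≤ u (mkPt (m+1) y 0) := hpos _ (le_of_eq (mkPt_last (m := m) y 0).symm)
      simp only [bPt]
      rw [abs_of_nonneg this])
  have hid : (∫ x in {x : EuclideanSpace ℝ (Fin (m+1)) | 0 < x (Fin.last m)},
      ρ (x (Fin.last m)) * ∑ j, pd (m+1) u j x * pd (m+1) u j x) = _ := hident
  obtain ⟨hR, hEq⟩ := hP
  rw [hid, eA, eB] at hEq
  have hp0 : 2 * ((m:ℝ)+1) / ((m:ℝ)-1) ≠ 0 := by
    have : (0:ℝ) < (m:ℝ) - 1 := by linarith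
    positivity
  intro x hx
  exact poho_zero m ρ hρC1 (fun s hs => (hρ1 s hs).1) _ hp0 u hu hLp hR (by linarith) x hx
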